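/- Let (C, Δ, ε, u) be a connected coaugmented cofiltered coalgebra over a commutative ring k, with filtration (C^n)_{n≥0}. Let Δ̄ : C → C ⊗ C be the k-linear map Δ̄(x) = Δ(x) − x ⊗ u(1) − u(1) ⊗ x, and define iterates Δ̄^1 = Δ̄ and Δ̄^{m+1} = (id_C ⊗ Δ̄^m) ∘ Δ̄ : C → C^{⊗(m+2)}. Then for all n ≥ 1, all x ∈ C^n ∩ ker ε, and all m ≥ n, one has Δ̄^m(x) = 0. -/

import Mathlib

open TensorProduct

universe u v

/-- The image of `P ⊗ Q` in `C ⊗ C`, for submodules `P Q : Submodule k C`. -/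
noncomputable def tensorImage {k C : Type*} [CommRing k] [AddCommGroup C] [Module k C]
    (P Q : Submodule k C) : Submodule k (C ⊗[k] C) :=
  LinearMap.range (TensorProduct.map P.subtype Q.subtype)

/-- `Tpow k C m` is the `(m+1)`-fold iterated tensor power `C ⊗ (C ⊗ (⋯ ⊗ C))`. -/
noncomputable def Tpow (k : Type u) (C : Type v) [CommRing k] [AddCommGroup C] [Module k C] :
    ℕ → ModuleCat.{v} k
  | 0 => ModuleCat.of k C
  | (n + 1) => ModuleCat.of k (C ⊗[k] (Tpow k C n))

/-- Iterates of a map `Δ̄ : C → C ⊗ C`: `Δ̄^0 = id` and `Δ̄^{m+1} = (id_C ⊗ Δ̄^m) ∘ Δ̄`.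
In particular `Δ̄^1 = (id_C ⊗ id) ∘ Δ̄ = Δ̄`, and `Δ̄^m : C → C^{⊗(m+1)}`. -/
noncomputable def reducedComulIterate {k : Type u} {C : Type v}
    [CommRing k] [AddCommGroup C] [Module k C]
    (Dbar : C →ₗ[k] C ⊗[k] C) : (m : ℕ) → (C →ₗ[k] Tpow k C m)
  | 0 => LinearMap.id
  | (m + 1) => (LinearMap.lTensor C (reducedComulIterate Dbar m)) ∘ₗ Dbar

/-- The reduced coproduct `Δ̄(x) = Δ(x) - x ⊗ u(1) - u(1) ⊗ x` as a linear map. -/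
noncomputable def reducedComul {k C : Type*} [CommRing k] [AddCommGroup C] [Module k C]
    [Coalgebra k C] (u : k →ₗ[k] C) : C →ₗ[k] C ⊗[k] C :=
  Coalgebra.comul - (TensorProduct.mk k C C).flip (u 1) - TensorProduct.mk k C C (u 1)

/-- On the kernel of the counit, the reduced coproduct is `(π ⊗ π) ∘ Δ` for `π = id - u ∘ ε`. -/
theorem reducedComul_eq_map_comul {k C : Type*} [CommRing k] [AddCommGroup C] [Module k C]
    [Coalgebra k C] (u : k →ₗ[k] C) {x : C} (hx : Coalgebra.counit (R := k) x = 0) :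
    reducedComul u x =
      TensorProduct.map (LinearMap.id - u ∘ₗ Coalgebra.counit)
        (LinearMap.id - u ∘ₗ Coalgebra.counit) (Coalgebra.comul (R := k) x) := by
  have hl : TensorProduct.map (u ∘ₗ Coalgebra.counit) LinearMap.id
      (Coalgebra.comul (R := k) x) = u 1 ⊗ₜ[k] x := by
    have h := congrArg (u.rTensor C) (Coalgebra.rTensor_counit_comul (R := k) x)
    rwa [← LinearMap.comp_apply, ← LinearMap.rTensor_comp, LinearMap.rTensor_tmul] at h
  have hr : TensorProduct.map LinearMap.id (u ∘ₗ Coalgebra.counit)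
      (Coalgebra.comul (R := k) x) = x ⊗ₜ[k] u 1 := by
    have h := congrArg (u.lTensor C) (Coalgebra.lTensor_counit_comul (R := k) x)
    rwa [← LinearMap.comp_apply, ← LinearMap.lTensor_comp, LinearMap.lTensor_tmul] at h
  have hlr : TensorProduct.map (u ∘ₗ Coalgebra.counit) (u ∘ₗ Coalgebra.counit)
      (Coalgebra.comul (R := k) x) = 0 := by
    have h := congrArg (TensorProduct.map LinearMap.id (u ∘ₗ Coalgebra.counit)) hl
    rw [← LinearMap.comp_apply, ← TensorProduct.map_comp] at h
    simpa [hx] using h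
  rw [← TensorProduct.mapBilinear_apply] at hl hr hlr
  have hid : TensorProduct.mapBilinear (.id k) C C C C LinearMap.id LinearMap.id
      (Coalgebra.comul (R := k) x) = Coalgebra.comul (R := k) x := by
    rw [TensorProduct.mapBilinear_apply, TensorProduct.map_id, LinearMap.id_apply]
  rw [← TensorProduct.mapBilinear_apply]
  simp only [map_sub, LinearMap.sub_apply, hl, hr, hlr, hid, reducedComul,
    LinearMap.flip_apply, TensorProduct.mk_apply]
  abel

/-- Let `(C, Δ, ε, u)` be a connected coaugmented cofiltered coalgebra with
filtration `(Cⁿ)ₙ`, and let `Δ̄(x) = Δ(x) - x ⊗ u(1) - u(1) ⊗ x` be the reduced coproduct,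
with iterates `Δ̄^{m+1} = (id ⊗ Δ̄^m) ∘ Δ̄`. Then for all `n ≥ 1`, all `x ∈ Cⁿ ∩ ker ε` and
all `m ≥ n`, we have `Δ̄^m(x) = 0`. -/
theorem reducedComulIterate_eq_zero_of_filtration
    {k : Type u} {C : Type v} [CommRing k] [AddCommGroup C] [Module k C] [Coalgebra k C]
    (u : k →ₗ[k] C)
    (hu : (Coalgebra.counit (R := k) (A := C)) ∘ₗ u = LinearMap.id)
    (F : ℕ → Submodule k C)
    (hexh : ∀ x : C, ∃ n, x ∈ F n)
    (hmono : ∀ n, F n ≤ F (n + 1))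
    (hcomul : ∀ n, ∀ x ∈ F n, Coalgebra.comul x ∈
      ⨆ (p : ℕ) (q : ℕ) (_ : p + q = n), tensorImage (F p) (F q))
    (hsplit : ∀ n, F n = LinearMap.range u ⊔
      (F n ⊓ LinearMap.ker (Coalgebra.counit (R := k) (A := C))))
    (hconn : F 0 = LinearMap.range u) :
    ∀ n, 1 ≤ n →
      ∀ x ∈ F n ⊓ LinearMap.ker (Coalgebra.counit (R := k) (A := C)),
        ∀ m, n ≤ m → reducedComulIterate (reducedComul u) m x = 0 := by
  have hcu (c : k) : Coalgebra.counit (R := k) (u c) = c := LinearMap.congr_fun hu c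
  have hproj (q : ℕ) (b : C) (hb : b ∈ F q) :
      b - u (Coalgebra.counit (R := k) b) ∈ F q ⊓ LinearMap.ker (Coalgebra.counit (R := k)) := by
    refine ⟨sub_mem hb ?_, by simp [hcu]⟩
    rw [hsplit q]
    exact Submodule.mem_sup_left ⟨_, rfl⟩
  have hzero (x : C) (hx : x ∈ F 0 ⊓ LinearMap.ker (Coalgebra.counit (R := k))) : x = 0 := by
    obtain ⟨hx0, hxε⟩ := hx
    rw [hconn] at hx0
    obtain ⟨c, rfl⟩ := hx0
    have hc : c = 0 := by simpa [hcu] using hxε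
    simp [hc]
  suffices H : ∀ m n, n ≤ m → ∀ x ∈ F n ⊓ LinearMap.ker (Coalgebra.counit (R := k) (A := C)),
      reducedComulIterate (reducedComul u) m x = 0 from fun n _ x hx m hnm => H m n hnm x hx
  intro m
  induction m with
  | zero =>
    intro n hn x hx
    obtain rfl : n = 0 := Nat.le_zero.mp hn
    rw [hzero x hx, map_zero]
  | succ m ih =>
    intro n hn x hx
    change LinearMap.lTensor C (reducedComulIterate (reducedComul u) m) (reducedComul u x) = 0
    rw [reducedComul_eq_map_comul u hx.2, ← LinearMap.comp_apply, ← LinearMap.mem_ker]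
    refine (iSup_le fun p => iSup_le fun q => iSup_le fun hpq => ?_ :
      (⨆ (p : ℕ) (q : ℕ) (_ : p + q = n), tensorImage (F p) (F q)) ≤ _) (hcomul n x hx.1)
    rw [tensorImage, LinearMap.range_le_ker_iff]
    refine TensorProduct.ext' fun a b => ?_
    change (a.1 - u (Coalgebra.counit (R := k) a.1)) ⊗ₜ[k]
      reducedComulIterate (reducedComul u) m (b.1 - u (Coalgebra.counit (R := k) b.1)) = 0
    rcases Nat.eq_zero_or_pos p with rfl | hp
    · rw [hzero _ (hproj 0 a.1 a.2), TensorProduct.zero_tmul]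
    · rw [ih q (by omega) _ (hproj q b.1 b.2), TensorProduct.tmul_zero]
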